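/- For real $y > 0$ and complex $\nu$ with $\mathrm{Re}(\nu) > -1/2$, the modified Bessel function satisfies the bound $\left|\frac{K_{ir}(2\pi m y)}{\Gamma(\frac12 + ir)}\right| \ll \frac{1 + |r|^3}{m^3 y^3}$ for real $r$ and positive integer $m$; more precisely, using $K_\nu(y) = \frac{2^\nu \Gamma(\nu + \frac12)}{y^\nu \sqrt\pi}\int_0^\infty \frac{\cos(yt)}{(1+t^2)^{\nu + \frac12}}dt$, three integrations by parts of the cosine integral yield $\left|\int_0^\infty \frac{\cos(yt)}{(1+t^2)^{\nu+\frac12}}dt\right| \leq \frac{C(1+|\nu|^3)}{y^3}$ for $\mathrm{Re}(\nu) = 0$ and $y \geq 1$. -/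

import Mathlib

open MeasureTheory

namespace Aux13

noncomputable def g (s : ℂ) (t : ℝ) : ℂ := ((1 + t ^ 2 : ℝ) : ℂ) ^ s

lemma g_deriv (s : ℂ) (t : ℝ) : HasDerivAt (g s) (2 * s * t * g (s - 1) t) t := by
  have h1 : HasDerivAt (fun z : ℂ => 1 + z ^ 2) (2 * (t : ℂ)) (t : ℂ) := by
    simpa using (hasDerivAt_pow 2 (t : ℂ)).const_add 1
  have h3 : (1 : ℂ) + (t : ℂ) ^ 2 = ((1 + t ^ 2 : ℝ) : ℂ) := by push_cast; rfl
  have h2 := (h1.cpow_const (c := s)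
    (Or.inl (by rw [h3, Complex.ofReal_re]; positivity))).comp_ofReal
  unfold g
  push_cast
  refine h2.congr_deriv ?_
  ring

lemma g_cont (s : ℂ) : Continuous (g s) :=
  continuous_iff_continuousAt.2 fun t => (g_deriv s t).continuousAt

lemma g_norm (s : ℂ) (t : ℝ) : ‖g s t‖ = (1 + t ^ 2) ^ s.re := by
  unfold g
  rw [Complex.norm_cpow_eq_rpow_re_of_pos (by positivity)]

/-- `t^k (1+t²)^s` is bounded by a power of `1+t²`. -/
lemma g_bound (s : ℂ) (t : ℝ) (k : ℕ) (e : ℝ) (h : (k : ℝ) / 2 + s.re ≤ e) :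
    ‖(t : ℂ) ^ k * g s t‖ ≤ (1 + t ^ 2) ^ e := by
  have hp : (0 : ℝ) < 1 + t ^ 2 := by positivity
  rw [norm_mul, norm_pow, Complex.norm_real, g_norm, Real.norm_eq_abs]
  have h1 : |t| ≤ (1 + t ^ 2) ^ (1 / 2 : ℝ) := by
    rw [← Real.sqrt_eq_rpow]
    apply Real.abs_le_sqrt; linarith
  have h2 : |t| ^ k ≤ (1 + t ^ 2) ^ ((k : ℝ) / 2) := by
    calc |t| ^ k ≤ ((1 + t ^ 2) ^ (1 / 2 : ℝ)) ^ k := by gcongr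
      _ = _ := by rw [← Real.rpow_natCast, ← Real.rpow_mul hp.le]; congr 1; ring
  calc _ ≤ (1 + t ^ 2) ^ ((k : ℝ) / 2) * (1 + t ^ 2) ^ s.re := by gcongr
    _ = (1 + t ^ 2) ^ ((k : ℝ) / 2 + s.re) := by rw [Real.rpow_add hp]
    _ ≤ _ := Real.rpow_le_rpow_of_exponent_le (by nlinarith [sq_nonneg t]) h

noncomputable def f1 (s : ℂ) (t : ℝ) : ℂ := 2 * s * (t * g (s - 1) t)
noncomputable def f2 (s : ℂ) (t : ℝ) : ℂ :=
  2 * s * g (s - 1) t + 4 * s * (s - 1) * (t ^ 2 * g (s - 2) t)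
noncomputable def f3 (s : ℂ) (t : ℝ) : ℂ :=
  12 * s * (s - 1) * (t * g (s - 2) t) + 8 * s * (s - 1) * (s - 2) * (t ^ 3 * g (s - 3) t)

lemma id_deriv (t : ℝ) : HasDerivAt (fun t : ℝ => (t : ℂ)) 1 t := by
  simpa using (hasDerivAt_id t).ofReal_comp

lemma f1_deriv (s : ℂ) (t : ℝ) : HasDerivAt (f1 s) (f2 s t) t := by
  unfold f1 f2
  have h := ((id_deriv t).mul (g_deriv (s - 1) t)).const_mul (2 * s)
  refine h.congr_deriv ?_
  rw [show s - 1 - 1 = s - 2 by ring]; ring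

lemma f2_deriv (s : ℂ) (t : ℝ) : HasDerivAt (f2 s) (f3 s t) t := by
  unfold f2 f3
  have h := ((g_deriv (s - 1) t).const_mul (2 * s)).add
    ((((id_deriv t).pow 2).mul (g_deriv (s - 2) t)).const_mul (4 * s * (s - 1)))
  refine h.congr_deriv ?_
  rw [show s - 1 - 1 = s - 2 by ring, show s - 2 - 1 = s - 3 by ring]
  simp; ring

lemma f3_cont (s : ℂ) : Continuous (f3 s) := by
  unfold f3
  have := g_cont (s - 2)
  have := g_cont (s - 3)
  fun_prop

noncomputable def F (s : ℂ) (y : ℝ) (t : ℝ) : ℂ :=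
  Complex.sin (y * t) * g s t / y + Complex.cos (y * t) * f1 s t / y ^ 2
    - Complex.sin (y * t) * f2 s t / y ^ 3

lemma F_deriv (s : ℂ) (y : ℝ) (hy : 1 ≤ y) (t : ℝ) :
    HasDerivAt (F s y) (Complex.cos (y * t) * g s t
      - Complex.sin (y * t) * f3 s t / y ^ 3) t := by
  have hy0 : (y : ℂ) ≠ 0 := by
    have : y ≠ 0 := by linarith
    exact_mod_cast this
  have hl : HasDerivAt (fun z : ℂ => (y : ℂ) * z) y (t : ℂ) := by
    simpa using (hasDerivAt_id (t : ℂ)).const_mul (y : ℂ)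
  have hs := hl.csin.comp_ofReal
  have hc := hl.ccos.comp_ofReal
  have h := (((hs.mul (g_deriv s t)).div_const (y : ℂ)).add
    ((hc.mul (f1_deriv s t)).div_const ((y : ℂ) ^ 2))).sub
    ((hs.mul (f2_deriv s t)).div_const ((y : ℂ) ^ 3))
  refine h.congr_deriv ?_
  simp only [f1]
  field_simp
  ring

lemma norm_sin_le (x y : ℝ) : ‖Complex.sin (x * y)‖ ≤ 1 := by
  rw [← Complex.ofReal_mul, ← Complex.ofReal_sin, Complex.norm_real]
  exact Real.abs_sin_le_one _

lemma norm_cos_le (x y : ℝ) : ‖Complex.cos (x * y)‖ ≤ 1 := by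
  rw [← Complex.ofReal_mul, ← Complex.ofReal_cos, Complex.norm_real]
  exact Real.abs_cos_le_one _

lemma div_bound (a b : ℂ) (y : ℝ) (hy : 1 ≤ y) (k : ℕ) (ha : ‖a‖ ≤ 1) :
    ‖a * b / (y : ℂ) ^ k‖ ≤ ‖b‖ := by
  rw [norm_div, norm_mul, norm_pow, Complex.norm_real, Real.norm_eq_abs,
    abs_of_nonneg (by linarith)]
  calc _ ≤ ‖a‖ * ‖b‖ := div_le_self (by positivity) (one_le_pow₀ hy)
    _ ≤ 1 * ‖b‖ := by gcongr
    _ = _ := one_mul _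

lemma F_bound (s : ℂ) (hs : s.re = -1 / 2) (y : ℝ) (hy : 1 ≤ y) (t : ℝ) :
    ‖F s y t‖ ≤ (1 + ‖2 * s‖ + (‖2 * s‖ + ‖4 * s * (s - 1)‖)) * (1 + t ^ 2) ^ (-1 / 2 : ℝ) := by
  have a0 := g_bound s t 0 (-1 / 2) (by norm_num [hs])
  have a1 := g_bound (s - 1) t 1 (-1 / 2) (by norm_num [hs])
  have a2 := g_bound (s - 1) t 0 (-1 / 2) (by norm_num [hs])
  have a3 := g_bound (s - 2) t 2 (-1 / 2) (by norm_num [hs])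
  rw [pow_zero, one_mul] at a0 a2
  rw [pow_one] at a1
  set E := (1 + t ^ 2) ^ (-1 / 2 : ℝ)
  have b0 := div_bound _ (g s t) y hy 1 (norm_sin_le y t)
  have b1 := div_bound _ (f1 s t) y hy 2 (norm_cos_le y t)
  have b2 := div_bound _ (f2 s t) y hy 3 (norm_sin_le y t)
  rw [pow_one] at b0
  have c1 : ‖f1 s t‖ ≤ ‖2 * s‖ * E := by
    unfold f1; rw [norm_mul]; gcongr
  have c2 : ‖f2 s t‖ ≤ ‖2 * s‖ * E + ‖4 * s * (s - 1)‖ * E := by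
    unfold f2
    refine (norm_add_le _ _).trans ?_
    rw [norm_mul _ (g _ _), norm_mul _ ((t : ℂ) ^ 2 * _)]; gcongr
  unfold F
  refine (norm_sub_le _ _).trans ?_
  have := norm_add_le (Complex.sin (y * t) * g s t / y) (Complex.cos (y * t) * f1 s t / y ^ 2)
  linarith

lemma f3_bound (s : ℂ) (hs : s.re = -1 / 2) (a : ℝ) (ha : 0 ≤ a) (hsa : ‖s‖ ≤ a + 1 / 2) (t : ℝ) :
    ‖f3 s t‖ ≤ 1296 * (1 + a ^ 3) * (1 + t ^ 2)⁻¹ := by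
  have a1 := g_bound (s - 2) t 1 (-1) (by norm_num [hs])
  have a2 := g_bound (s - 3) t 3 (-1) (by norm_num [hs])
  rw [pow_one] at a1
  rw [Real.rpow_neg_one] at a1 a2
  have n0 : ‖s‖ ≤ a + 3 := by linarith
  have n1 : ‖s - 1‖ ≤ a + 3 := by
    have := norm_sub_le s 1
    rw [norm_one] at this; linarith
  have n2 : ‖s - 2‖ ≤ a + 3 := by
    have := norm_sub_le s 2
    rw [Complex.norm_ofNat] at this; linarith
  have hE : 0 < (1 + t ^ 2)⁻¹ := by positivity
  set E := (1 + t ^ 2)⁻¹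
  calc ‖f3 s t‖ ≤ 12 * ‖s‖ * ‖s - 1‖ * ‖t * g (s - 2) t‖
        + 8 * ‖s‖ * ‖s - 1‖ * ‖s - 2‖ * ‖t ^ 3 * g (s - 3) t‖ := by
        unfold f3
        refine (norm_add_le _ _).trans (le_of_eq ?_)
        rw [norm_mul _ ((t : ℂ) * _), norm_mul _ ((t : ℂ) ^ 3 * _)]
        simp only [norm_mul _ (s - 1), norm_mul _ (s - 2), norm_mul _ s, Complex.norm_ofNat]
    _ ≤ 12 * (a + 3) * (a + 3) * E + 8 * (a + 3) * (a + 3) * (a + 3) * E := by gcongr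
    _ = (12 * (a + 3) * (a + 3) + 8 * (a + 3) * (a + 3) * (a + 3)) * E := by ring
    _ ≤ _ := by
        gcongr
        have : 0 ≤ a ^ 3 := by positivity
        nlinarith [mul_nonneg ha (sq_nonneg (a - 3)), mul_nonneg ha ha, sq_nonneg (a - 3),
          sq_nonneg (a - 1), mul_nonneg ha (sq_nonneg (a - 1))]

lemma int_bound (s : ℂ) (hs : s.re = -1 / 2) (a : ℝ) (ha : 0 ≤ a) (hsa : ‖s‖ ≤ a + 1 / 2)
    (y : ℝ) (T : ℝ) (hT : 0 ≤ T) :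
    ‖∫ t in (0 : ℝ)..T, Complex.sin (y * t) * f3 s t‖ ≤ 2592 * (1 + a ^ 3) := by
  have h1 : ‖∫ t in (0 : ℝ)..T, Complex.sin (y * t) * f3 s t‖ ≤
      ∫ t in (0 : ℝ)..T, 1296 * (1 + a ^ 3) * (1 + t ^ 2)⁻¹ := by
    apply intervalIntegral.norm_integral_le_of_norm_le hT
    · refine Filter.Eventually.of_forall fun t _ => ?_
      rw [norm_mul]
      calc _ ≤ 1 * ‖f3 s t‖ := by gcongr; exact norm_sin_le y t
        _ ≤ _ := by rw [one_mul]; exact f3_bound s hs a ha hsa t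
    · apply Continuous.intervalIntegrable
      have : ∀ t : ℝ, 1 + t ^ 2 ≠ 0 := fun t => by positivity
      fun_prop (disch := assumption)
  refine h1.trans ?_
  rw [intervalIntegral.integral_const_mul, integral_inv_one_add_sq, Real.arctan_zero, sub_zero]
  have h2 : Real.arctan T ≤ 2 := by
    have := Real.arctan_lt_pi_div_two T
    have := Real.pi_lt_four
    linarith
  have : 0 ≤ 1296 * (1 + a ^ 3) := by positivity
  nlinarith

lemma F_zero (s : ℂ) (y : ℝ) : F s y 0 = 0 := by simp [F, f1]

lemma main_eq (s : ℂ) (y : ℝ) (hy : 1 ≤ y) (T : ℝ) :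
    ∫ t in (0 : ℝ)..T, Complex.cos (y * t) * g s t =
      F s y T + (∫ t in (0 : ℝ)..T, Complex.sin (y * t) * f3 s t) / y ^ 3 := by
  have hg := g_cont s
  have hf := f3_cont s
  have c1 : Continuous fun t : ℝ => Complex.cos (y * t) * g s t := by fun_prop
  have c2 : Continuous fun t : ℝ => Complex.sin (y * t) * f3 s t / (y : ℂ) ^ 3 := by fun_prop
  have h := intervalIntegral.integral_eq_sub_of_hasDerivAt (a := 0) (b := T)
    (fun t _ => F_deriv s y hy t) ((c1.sub c2).intervalIntegrable _ _)
  rw [intervalIntegral.integral_sub (c1.intervalIntegrable _ _) (c2.intervalIntegrable _ _),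
    F_zero, intervalIntegral.integral_div] at h
  linear_combination h

lemma decay : Filter.Tendsto (fun T : ℝ => (1 + T ^ 2) ^ (-1 / 2 : ℝ)) Filter.atTop (nhds 0) := by
  have h := tendsto_rpow_neg_atTop (y := 1 / 2) (by norm_num)
  have h2 : Filter.Tendsto (fun T : ℝ => 1 + T ^ 2) Filter.atTop Filter.atTop :=
    Filter.tendsto_atTop_add_const_left _ _ (Filter.tendsto_pow_atTop (by norm_num))
  have := h.comp h2
  rw [neg_div]
  exact this

end Aux13

/-- Three integrations by parts give, for `ν = ir` purely imaginary and `y ≥ 1`,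
`|∫_0^∞ cos(yt) (1+t²)^{-ir-1/2} dt| ≤ C (1+|r|³)/y³` for an absolute constant `C`
(the integral interpreted as the limit of `∫_0^T`). -/
theorem stmt_13 :
    ∃ C : ℝ, 0 < C ∧ ∀ r y : ℝ, 1 ≤ y → ∀ I : ℂ,
      Filter.Tendsto (fun T : ℝ => ∫ t in (0 : ℝ)..T,
          Complex.cos (y * t) * ((1 + t ^ 2 : ℝ) : ℂ) ^ (-(Complex.I * r) - 1 / 2))
        Filter.atTop (nhds I) →
      ‖I‖ ≤ C * (1 + |r| ^ 3) / y ^ 3 := by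
  refine ⟨2592, by norm_num, fun r y hy I hI => ?_⟩
  set s : ℂ := -(Complex.I * r) - 1 / 2 with hsdef
  have hs : s.re = -1 / 2 := by simp [hsdef]; norm_num
  have hsa : ‖s‖ ≤ |r| + 1 / 2 := by
    refine (norm_sub_le _ _).trans (le_of_eq ?_)
    simp
  have hlim := (Aux13.decay.const_mul
    (1 + ‖2 * s‖ + (‖2 * s‖ + ‖4 * s * (s - 1)‖))).add_const (2592 * (1 + |r| ^ 3) / y ^ 3)
  rw [mul_zero, zero_add] at hlim
  refine le_of_tendsto_of_tendsto hI.norm hlim ?_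
  filter_upwards [Filter.eventually_ge_atTop 0] with T hT
  have e := Aux13.main_eq s y hy T
  unfold Aux13.g at e
  rw [e]
  refine (norm_add_le _ _).trans (add_le_add (Aux13.F_bound s hs y hy T) ?_)
  have hy0 : 0 < y := by linarith
  rw [norm_div, norm_pow, Complex.norm_real, Real.norm_eq_abs, abs_of_pos hy0]
  have := Aux13.int_bound s hs |r| (abs_nonneg r) hsa y T hT
  gcongr
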